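/- arXiv:2409.02868 — 4 statements merged into one kernel-verified Lean document; each statement's English description precedes it below -/
import Mathlib

section
/- Let H be a complex Hilbert space, N ≥ 1 an integer, A : ℝ → B(H) a family of bounded linear operators, and z₁, …, z_N : ℝ → H differentiable curves satisfying zⱼ'(s) = −A(s) zⱼ(s) for all s and each j = 1, …, N. For each s, let P(s) be the orthogonal projection of H onto the finite-dimensional (hence closed) subspace span{z₁(s), …, z_N(s)}, and suppose the operator-valued map s ↦ P(s) is differentiable at s₀ in operator norm with derivative P'(s₀). Then for every h ∈ H, P'(s₀)(P(s₀) h) = −(I − P(s₀)) A(s₀) (P(s₀) h). -/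
/-- A vector of a subspace is fixed by any map sending it into the subspace with orthogonal
residual. -/
theorem apply_eq_self_of_mem_of_sub_mem_orthogonal
    {H : Type*} [NormedAddCommGroup H] [InnerProductSpace ℂ H] (K : Submodule ℂ H)
    (p : H → H) {x : H} (hx : x ∈ K) (hp : p x ∈ K) (hp' : x - p x ∈ Kᗮ) : p x = x := by
  have h0 : x - p x ∈ K ⊓ Kᗮ := ⟨K.sub_mem hx hp, hp'⟩
  rw [K.inf_orthogonal_eq_bot, Submodule.mem_bot] at h0
  exact (sub_eq_zero.mp h0).symm

/-- Product rule for a real-parameter family of complex-linear operators applied to a curve. -/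
theorem HasDerivAt.complex_clm_apply
    {H : Type*} [NormedAddCommGroup H] [InnerProductSpace ℂ H]
    {P : ℝ → (H →L[ℂ] H)} {P' : H →L[ℂ] H} {u : ℝ → H} {u' : H} {s : ℝ}
    (hP : HasDerivAt P P' s) (hu : HasDerivAt u u' s) :
    HasDerivAt (fun t => P t (u t)) (P' (u s) + P s u') s := by
  have hR : HasDerivAt (fun t => (P t).restrictScalars ℝ) (P'.restrictScalars ℝ) s :=
    (ContinuousLinearMap.restrictScalarsL ℂ H H ℝ ℝ).hasFDerivAt.comp_hasDerivAt s hP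
  exact hR.clm_apply hu


/-- If `z₁, …, z_N : ℝ → H` solve `zⱼ' = −A(s) zⱼ` and `P(s)` is the
orthogonal projection onto `span{z₁(s), …, z_N(s)}` (characterized by `P(s)h` belonging to
the span and `h − P(s)h` being orthogonal to it), and `s ↦ P(s)` is differentiable at `s₀`
in operator norm with derivative `P'`, then `P'(s₀) P(s₀) h = −(I − P(s₀)) A(s₀) P(s₀) h`
for every `h ∈ H`. -/
theorem deriv_of_projection_onto_solution_span
    {H : Type*} [NormedAddCommGroup H] [InnerProductSpace ℂ H] [CompleteSpace H]
    (N : ℕ) (hN : 1 ≤ N)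
    (A : ℝ → (H →L[ℂ] H)) (z : Fin N → ℝ → H)
    (hz : ∀ (j : Fin N) (s : ℝ), HasDerivAt (z j) (-(A s (z j s))) s)
    (P : ℝ → (H →L[ℂ] H))
    (hP : ∀ s : ℝ, ∀ h : H,
      P s h ∈ Submodule.span ℂ (Set.range fun j : Fin N => z j s) ∧
      h - P s h ∈ (Submodule.span ℂ (Set.range fun j : Fin N => z j s))ᗮ)
    (s₀ : ℝ) (P' : H →L[ℂ] H)
    (hP' : HasDerivAt P P' s₀) :
    ∀ h : H, P' (P s₀ h) = -(A s₀ (P s₀ h) - P s₀ (A s₀ (P s₀ h))) := by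
  have key : ∀ x ∈ Submodule.span ℂ (Set.range fun j : Fin N => z j s₀),
      P' x = -(A s₀ x - P s₀ (A s₀ x)) := by
    intro x hx
    induction hx using Submodule.span_induction with
    | mem x hx =>
      obtain ⟨j, rfl⟩ := hx
      have hfix : (fun t => P t (z j t)) = z j := by
        funext t
        exact apply_eq_self_of_mem_of_sub_mem_orthogonal
          (Submodule.span ℂ (Set.range fun j : Fin N => z j t)) (P t)
          (Submodule.subset_span (Set.mem_range_self j)) (hP t _).1 (hP t _).2
      have hd := hP'.complex_clm_apply (hz j s₀)
      rw [hfix] at hd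
      have he := hd.unique (hz j s₀)
      rw [map_neg] at he
      rw [eq_sub_of_add_eq he]
      abel
    | zero => simp
    | add x y _ _ hx hy =>
      simp only [map_add, hx, hy]
      abel
    | smul c x _ hx => simp only [map_smul, hx, smul_neg, smul_sub]
  exact fun h => key _ (hP s₀ h).1
end

section
/- Let H be a complex Hilbert space and P : ℝ → B(H) a family of self-adjoint idempotents (P(s)² = P(s) and P(s)* = P(s) for all s) that is differentiable at s₀ in operator norm with derivative P'(s₀). Let A ∈ B(H) and suppose that P'(s₀) ∘ P(s₀) = −(I − P(s₀)) A P(s₀). Then for every h ∈ H, P'(s₀) h = −(I − P(s₀)) A P(s₀) h − P(s₀) A* (I − P(s₀)) h, where A* denotes the Hilbert-space adjoint of A. -/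
/-- The derivative of a differentiable family of idempotents satisfies `d = d p + p d`. -/
theorem HasDerivAt.eq_mul_add_mul_of_isIdempotentElem {R : Type*} [NormedRing R]
    [NormedAlgebra ℝ R] {p : ℝ → R} {d : R} {s : ℝ} (hp : ∀ t, IsIdempotentElem (p t))
    (hd : HasDerivAt p d s) : d = d * p s + p s * d := by
  have hmul : p * p = p := funext hp
  have h := hd.mul hd
  rw [hmul] at h
  exact hd.unique h

/-- The derivative of a differentiable family of self-adjoint elements is self-adjoint. -/
theorem HasDerivAt.isSelfAdjoint {E : Type*} [NormedAddCommGroup E] [NormedSpace ℝ E]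
    [StarAddMonoid E] [ContinuousStar E] [StarModule ℝ E] {p : ℝ → E} {d : E} {s : ℝ}
    (hp : ∀ t, IsSelfAdjoint (p t)) (hd : HasDerivAt p d s) : IsSelfAdjoint d := by
  have hstar : (fun t => star (p t)) = p := funext hp
  have h := hd.star
  rw [hstar] at h
  exact h.unique hd


/-- Let `P : ℝ → B(H)` be a family of orthogonal projections
(self-adjoint idempotents), differentiable at `s₀` in operator norm with derivative `P'`.
If `P' ∘ P(s₀) = −(I − P(s₀)) A P(s₀)`, then for every `h ∈ H`,
`P' h = −(I − P(s₀)) A P(s₀) h − P(s₀) A* (I − P(s₀)) h`. -/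
theorem deriv_of_projection_full_formula
    {H : Type*} [NormedAddCommGroup H] [InnerProductSpace ℂ H] [CompleteSpace H]
    (P : ℝ → (H →L[ℂ] H))
    (hidem : ∀ s : ℝ, (P s).comp (P s) = P s)
    (hself : ∀ s : ℝ, ContinuousLinearMap.adjoint (P s) = P s)
    (s₀ : ℝ) (P' : H →L[ℂ] H)
    (hP' : HasDerivAt P P' s₀)
    (A : H →L[ℂ] H)
    (hPP : ∀ h : H, P' (P s₀ h) = -(A (P s₀ h) - P s₀ (A (P s₀ h)))) :
    ∀ h : H, P' h = -(A (P s₀ h) - P s₀ (A (P s₀ h)))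
      - P s₀ (ContinuousLinearMap.adjoint A (h - P s₀ h)) := by
  intro h
  have hsum : P' = P' * P s₀ + P s₀ * P' := hP'.eq_mul_add_mul_of_isIdempotentElem hidem
  have hstar : star P' = P' := hP'.isSelfAdjoint hself
  have hright : P' * P s₀ = -(A * P s₀ - P s₀ * (A * P s₀)) := ContinuousLinearMap.ext hPP
  have hP : star (P s₀) = P s₀ := hself s₀
  have hleft : P s₀ * P' = -(P s₀ * (star A * (1 - P s₀))) := by
    have := congrArg star hright
    simp only [star_mul, star_neg, star_sub, hstar, hP] at this
    rw [this]
    noncomm_ring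
  rw [hright, hleft, ← sub_eq_add_neg] at hsum
  exact congrArg (fun T : H →L[ℂ] H => T h) hsum
end

section
/- Let j, k, l ∈ ℤ² with j ≠ 0, k ≠ 0, j + k = l and l₁ = 0. Then Γ_{jkl} + Γ_{kjl} = 4π² l₂ (λ_j + λ_k). In particular, if in addition λ_j + λ_k = 0, then Γ_{jkl} + Γ_{kjl} = 0. -/
/-- The interaction coefficients `Γ_{jkl} = (B(e^{ij·x}, e^{ik·x}), e^{il·x})`
of the vorticity-advection bilinear form on the torus `[0,2π] × [−π,π]`:
`Γ_{jkl} = 4π² (j₁k₂ − j₂k₁)/|j|²` if `j + k = l`, and `0` otherwise. -/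
noncomputable def Gammajkl (j k l : ℤ × ℤ) : ℝ :=
  if j + k = l then
    4 * Real.pi ^ 2 * ((j.1 * k.2 - j.2 * k.1 : ℤ) : ℝ) / ((j.1 ^ 2 + j.2 ^ 2 : ℤ) : ℝ)
  else 0

/-- `λ_k = k₁ / |k|²` for `k ∈ ℤ² \ {0}`. -/
noncomputable def lamk (k : ℤ × ℤ) : ℝ := (k.1 : ℝ) / ((k.1 ^ 2 + k.2 ^ 2 : ℤ) : ℝ)

theorem Gammajkl_eq_of_fst_eq_zero {j k l : ℤ × ℤ} (hjkl : j + k = l) (hl : l.1 = 0) :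
    Gammajkl j k l = 4 * Real.pi ^ 2 * (l.2 : ℝ) * lamk j := by
  have hk : k.1 = -j.1 := by
    rw [← hjkl, Prod.fst_add] at hl
    linarith
  have hcross : j.1 * k.2 - j.2 * k.1 = l.2 * j.1 := by
    rw [← hjkl, Prod.snd_add, hk]
    ring
  rw [Gammajkl, if_pos hjkl, hcross, lamk]
  push_cast
  ring

/-- For `j, k ≠ 0` with `j + k = l` and `l₁ = 0`,
`Γ_{jkl} + Γ_{kjl} = 4π² l₂ (λ_j + λ_k)`; in particular the sum vanishes
whenever `λ_j + λ_k = 0`. -/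
theorem Gamma_sum_eq
    (j k l : ℤ × ℤ) (hj : j ≠ 0) (hk : k ≠ 0) (hjkl : j + k = l) (hl : l.1 = 0) :
    Gammajkl j k l + Gammajkl k j l = 4 * Real.pi ^ 2 * (l.2 : ℝ) * (lamk j + lamk k) ∧
    (lamk j + lamk k = 0 → Gammajkl j k l + Gammajkl k j l = 0) := by
  have hsum : Gammajkl j k l + Gammajkl k j l =
      4 * Real.pi ^ 2 * (l.2 : ℝ) * (lamk j + lamk k) := by
    rw [Gammajkl_eq_of_fst_eq_zero hjkl hl,
      Gammajkl_eq_of_fst_eq_zero ((add_comm k j).trans hjkl) hl, mul_add]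
  exact ⟨hsum, fun h => by rw [hsum, h, mul_zero]⟩
end

section
/- There exists a universal constant c > 0 with the following property: for every integer N ≥ 1 and every orthonormal family a₁, …, a_N in the Hilbert space ℓ²(ℤ² \ {0}; ℂ), one has Σ_{j=1}^N Σ_{k ∈ ℤ² \ {0}} |k|² |aⱼ(k)|² ≥ c N². (This is the spectral form of the Rayleigh–Ritz lower bound Tr[−Δ P_N] ≥ c N² for an N-dimensional orthogonal projection P_N on the two-dimensional torus.) -/
open scoped ENNReal

/-- The squared moduli of the coordinates of a vector of `ℓ²` sum to its squared norm. -/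
theorem lp_two_tsum_enorm_sq {ι : Type*} (f : lp (fun _ : ι => ℂ) 2) :
    ∑' k, (‖f k‖₊ : ℝ≥0∞) ^ 2 = ENNReal.ofReal (‖f‖ ^ 2) := by
  have h := lp.hasSum_norm (p := 2) (by norm_num) f
  simp only [ENNReal.toReal_ofNat, Real.rpow_ofNat] at h
  rw [← h.tsum_eq, ENNReal.ofReal_tsum_of_nonneg (fun _ => by positivity) h.summable]
  refine tsum_congr fun k => ?_
  rw [ENNReal.ofReal_pow (norm_nonneg _), ofReal_norm]
  rfl

/-- Bessel's inequality for a unit coordinate vector of `ℓ²`. -/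
theorem Orthonormal.sum_enorm_sq_apply_le_one {ι κ : Type*} [Fintype κ]
    {a : κ → lp (fun _ : ι => ℂ) 2} (ha : Orthonormal ℂ a) (k : ι) :
    ∑ j, (‖a j k‖₊ : ℝ≥0∞) ^ 2 ≤ 1 := by
  classical
  have h := ha.sum_inner_products_le (lp.single 2 k (1 : ℂ)) (s := Finset.univ)
  rw [lp.norm_single (by norm_num)] at h
  simp only [lp.inner_single_right, RCLike.inner_apply, one_mul, RCLike.norm_conj, norm_one,
    one_pow] at h
  have h' := ENNReal.ofReal_le_ofReal h
  rw [ENNReal.ofReal_sum_of_nonneg fun _ _ => by positivity, ENNReal.ofReal_one] at h'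
  refine le_of_eq_of_le (Finset.sum_congr rfl fun j _ => ?_) h'
  rw [ENNReal.ofReal_pow (norm_nonneg _), ofReal_norm]
  rfl

/-- If the weight `w` is at least `R` off the finite set `S`, then an orthonormal family of `ℓ²`
has weighted energy at least `R (card κ - card S)`. -/
theorem Orthonormal.mul_card_le_weighted_sum {ι κ : Type*} [Fintype κ]
    {a : κ → lp (fun _ : ι => ℂ) 2} (ha : Orthonormal ℂ a) (w : ι → ℝ≥0∞) (R : ℝ≥0∞)
    (S : Finset ι) (hw : ∀ k ∉ S, R ≤ w k) :
    R * Fintype.card κ ≤ R * S.card + ∑ j, ∑' k, w k * (‖a j k‖₊ : ℝ≥0∞) ^ 2 := by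
  classical
  have hcard : (Fintype.card κ : ℝ≥0∞) = ∑' k, ∑ j, (‖a j k‖₊ : ℝ≥0∞) ^ 2 := by
    rw [Summable.tsum_finsetSum fun _ _ => ENNReal.summable]
    simp [lp_two_tsum_enorm_sq, ha.norm_eq_one]
  have hS : R * S.card = ∑' k, if k ∈ S then R else 0 := by
    rw [tsum_eq_sum (s := S) fun k hk => if_neg hk, Finset.sum_ite_mem, Finset.inter_self,
      Finset.sum_const, nsmul_eq_mul, mul_comm]
  rw [hcard, hS, ← Summable.tsum_finsetSum fun _ _ => ENNReal.summable,
    ← ENNReal.tsum_add, ← ENNReal.tsum_mul_left]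
  refine ENNReal.tsum_le_tsum fun k => ?_
  rw [← Finset.mul_sum]
  split_ifs with hk
  · exact le_add_right (mul_le_of_le_one_right' (ha.sum_enorm_sq_apply_le_one k))
  · rw [zero_add]
    gcongr
    exact hw k hk

/-- The nonzero lattice points of the box `[-m, m]²`. -/
noncomputable def puncturedBox (m : ℕ) : Finset {k : ℤ × ℤ // k ≠ 0} :=
  (Finset.Icc (-m : ℤ) m ×ˢ Finset.Icc (-m : ℤ) m).subtype (· ≠ 0)

theorem card_puncturedBox (m : ℕ) : (puncturedBox m).card = 4 * m ^ 2 + 4 * m := by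
  rw [puncturedBox, Finset.card_subtype, Finset.filter_ne', Finset.card_erase_of_mem (by simp),
    Finset.card_product, Int.card_Icc]
  have : ((m : ℤ) + 1 - -m).toNat = 2 * m + 1 := by omega
  rw [this, Nat.sub_eq_iff_eq_add (Nat.one_le_iff_ne_zero.mpr (by simp))]
  ring

theorem sq_le_of_notMem_puncturedBox {m : ℕ} {k : {k : ℤ × ℤ // k ≠ 0}}
    (hk : k ∉ puncturedBox m) : ((m : ℤ) + 1) ^ 2 ≤ k.val.1 ^ 2 + k.val.2 ^ 2 := by
  have h : ¬ (|k.val.1| ≤ m ∧ |k.val.2| ≤ m) := by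
    simpa [puncturedBox, abs_le, and_assoc] using hk
  rw [not_and_or, not_le, not_le] at h
  rw [← sq_abs k.val.1, ← sq_abs k.val.2]
  rcases h with h | h <;> nlinarith [sq_nonneg |k.val.1|, sq_nonneg |k.val.2|]

/-- There is a universal constant `c > 0` such that for every `N ≥ 1` and
every orthonormal family `a₁, …, a_N` in `ℓ²(ℤ² \ {0}; ℂ)`,
`Σ_{j=1}^N Σ_k |k|² |aⱼ(k)|² ≥ c N²` (the sums taken in `[0, ∞]`, so that the inner double
sum is allowed to be `+∞`). This is the Rayleigh–Ritz bound `Tr[−Δ P_N] ≥ c N²`. -/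
theorem rayleigh_ritz_lower_bound :
    ∃ c : ℝ, 0 < c ∧
      ∀ (N : ℕ), 1 ≤ N →
        ∀ a : Fin N → lp (fun _ : {k : ℤ × ℤ // k ≠ 0} => ℂ) 2,
          Orthonormal ℂ a →
            ENNReal.ofReal (c * (N : ℝ) ^ 2)
              ≤ ∑ j : Fin N, ∑' k : {k : ℤ × ℤ // k ≠ 0},
                  ENNReal.ofReal (((k.val.1 ^ 2 + k.val.2 ^ 2 : ℤ) : ℝ))
                    * (‖(a j : ∀ k : {k : ℤ × ℤ // k ≠ 0}, ℂ) k‖₊ : ℝ≥0∞) ^ 2 := by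
  refine ⟨1 / 32, by norm_num, fun N _ a ha => ?_⟩
  obtain ⟨m, hmN, hNm⟩ : ∃ m : ℕ, 16 * m ^ 2 ≤ N ∧ N ≤ 16 * (m + 1) ^ 2 := by
    have h₁ := Nat.sqrt_le' (N / 16)
    have h₂ := Nat.lt_succ_sqrt' (N / 16)
    exact ⟨Nat.sqrt (N / 16), by omega, by rw [Nat.succ_eq_add_one] at h₂; omega⟩
  have key := ha.mul_card_le_weighted_sum
    (fun k => ENNReal.ofReal (((k.val.1 ^ 2 + k.val.2 ^ 2 : ℤ) : ℝ)))
    (ENNReal.ofReal (((m : ℝ) + 1) ^ 2)) (puncturedBox m) fun _ hk =>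
      ENNReal.ofReal_le_ofReal (by exact_mod_cast sq_le_of_notMem_puncturedBox hk)
  rw [Fintype.card_fin, card_puncturedBox, ← ENNReal.ofReal_natCast, ← ENNReal.ofReal_natCast,
    ← ENNReal.ofReal_mul (by positivity), ← ENNReal.ofReal_mul (by positivity)] at key
  refine le_trans ?_ (tsub_le_iff_left.mpr key)
  rw [← ENNReal.ofReal_sub _ (by positivity)]
  refine ENNReal.ofReal_le_ofReal ?_
  have hm : (m : ℝ) ≤ m ^ 2 := by exact_mod_cast Nat.le_self_pow two_ne_zero m
  have hmN' : 16 * (m : ℝ) ^ 2 ≤ N := by exact_mod_cast hmN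
  have hNm' : (N : ℝ) ≤ 16 * (m + 1) ^ 2 := by exact_mod_cast hNm
  have hS : (N : ℝ) / 2 ≤ N - (4 * m ^ 2 + 4 * m) := by linarith
  push_cast
  calc (1 / 32 : ℝ) * N ^ 2 = N / 16 * (N / 2) := by ring
    _ ≤ (m + 1) ^ 2 * (N - (4 * m ^ 2 + 4 * m)) := by gcongr; linarith
    _ = _ := by ring
end
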